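/- For 0 ≤ β < α < π/2, the iterated integral ∫₀^{1} u^{m−1/2}(1−u)^{−1/2} (∫_u^1 v^{−1/2}(1−v)^{n−1/2} dv) du, arising from the series expansion of Y(h), equals m!·(1/2)_n/((m+1/2)·(1/2)_{m+n+1}) · ₃F₂(1/2, m+1/2, m+1; m+3/2, m+n+3/2; 1), for nonnegative integers m,n. -/

import Mathlib

open Real

/-- Pochhammer symbol (rising factorial) `(x)_n`. -/
noncomputable def poch (x : ℝ) (n : ℕ) : ℝ := (ascPochhammer ℝ n).eval x

open MeasureTheory Set
open scoped ENNReal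

lemma poch_succ (x : ℝ) (k : ℕ) : poch x (k + 1) = poch x k * (x + k) :=
  ascPochhammer_succ_eval k x

lemma poch_pos {x : ℝ} (hx : 0 < x) (k : ℕ) : 0 < poch x k :=
  ascPochhammer_pos k x hx

lemma poch_add (x : ℝ) (j k : ℕ) : poch x (j + k) = poch x j * poch (x + j) k := by
  simp [poch, ← ascPochhammer_mul]

lemma poch_div_poch_add_one {x : ℝ} (hx : 0 < x) (k : ℕ) :
    poch x k / poch (x + 1) k = x / (x + k) := by
  have h := poch_add x 1 k
  rw [add_comm 1 k, poch_succ] at h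
  have h1 : poch x 1 = x := by simp [poch]
  rw [h1, Nat.cast_one] at h
  have := (poch_pos (by linarith : 0 < x + 1) k).ne'
  rw [div_eq_div_iff this (by positivity), h]

lemma Real.Gamma_add_natCast_eq_poch_mul {x : ℝ} (hx : 0 < x) (k : ℕ) :
    Gamma (x + k) = poch x k * Gamma x := by
  induction k with
  | zero => simp [poch]
  | succ k ih =>
    rw [poch_succ, Nat.cast_succ, ← add_assoc, Gamma_add_one (by positivity), ih]
    ring

/-- The binomial series of `(1 - u) ^ (-a)`. -/
lemma hasSum_poch_div_factorial_mul_pow (a : ℝ) {u : ℝ} (hu0 : 0 ≤ u) (hu1 : u < 1) :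
    HasSum (fun k : ℕ => poch a k / k.factorial * u ^ k) ((1 - u) ^ (-a)) := by
  have h := (Real.one_div_one_sub_rpow_hasFPowerSeriesOnBall_zero a).hasSum (y := u) (by
    rw [Metric.mem_eball, edist_zero_right, ← ofReal_norm, Real.norm_of_nonneg hu0]
    simpa using hu1)
  rw [zero_add, one_div, ← Real.rpow_neg (by linarith)] at h
  convert! h using 2 with k
  rw [FormalMultilinearSeries.ofScalars_apply_eq, ← Ring.multichoose_eq, smul_eq_mul]
  congr 1
  rw [div_eq_iff (by positivity), mul_comm, ← nsmul_eq_mul,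
    Ring.factorial_nsmul_multichoose_eq_ascPochhammer, poch,
    Polynomial.ascPochhammer_smeval_eq_eval]

lemma lintegral_rpow_mul_one_sub_rpow {a b : ℝ} (ha : 0 < a) (hb : 0 < b) :
    ∫⁻ x in Ioo (0 : ℝ) 1, ENNReal.ofReal (x ^ (a - 1) * (1 - x) ^ (b - 1)) =
      ENNReal.ofReal (ProbabilityTheory.beta a b) := by
  have hB := ProbabilityTheory.beta_pos ha hb
  have h := ProbabilityTheory.lintegral_betaPDF_eq_one ha hb
  rw [ProbabilityTheory.lintegral_betaPDF] at h
  simp_rw [mul_assoc, ENNReal.ofReal_mul (one_div_pos.2 hB).le] at h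
  rw [lintegral_const_mul' _ _ ENNReal.ofReal_ne_top, one_div, ENNReal.ofReal_inv_of_pos hB] at h
  exact (ENNReal.eq_inv_of_mul_eq_one_left ((mul_comm _ _).trans h)).trans (inv_inv _)

lemma integrableOn_rpow_mul_one_sub_rpow {a b : ℝ} (ha : 0 < a) (hb : 0 < b) :
    IntegrableOn (fun x : ℝ => x ^ (a - 1) * (1 - x) ^ (b - 1)) (Icc 0 1) := by
  rw [integrableOn_Icc_iff_integrableOn_Ioo]
  refine ⟨by fun_prop, ?_⟩
  rw [hasFiniteIntegral_iff_ofReal, lintegral_rpow_mul_one_sub_rpow ha hb]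
  · exact ENNReal.ofReal_lt_top
  · filter_upwards [ae_restrict_mem measurableSet_Ioo] with x hx
    exact mul_nonneg (Real.rpow_nonneg hx.1.le _) (Real.rpow_nonneg (by linarith [hx.2]) _)

lemma lintegral_rpow_Ioo {s v : ℝ} (hs : 0 < s) (hv : 0 ≤ v) :
    ∫⁻ u in Ioo 0 v, ENNReal.ofReal (u ^ (s - 1)) = ENNReal.ofReal (v ^ s / s) := by
  have hint : IntervalIntegrable (fun u : ℝ => u ^ (s - 1)) volume 0 v :=
    intervalIntegral.intervalIntegrable_rpow' (by linarith)
  rw [Measure.restrict_congr_set Ioo_ae_eq_Ioc, ← ofReal_integral_eq_lintegral_ofReal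
    ((intervalIntegrable_iff_integrableOn_Ioc_of_le hv).1 hint),
    ← intervalIntegral.integral_of_le hv, integral_rpow (Or.inl (by linarith))]
  · simp [Real.zero_rpow hs.ne']
  · filter_upwards [ae_restrict_mem measurableSet_Ioc] with x hx
    exact Real.rpow_nonneg hx.1.le _

/-- Tonelli's theorem on the triangle `a < u < v < b`. -/
lemma lintegral_triangle_swap {f g : ℝ → ℝ≥0∞} (hf : Measurable f) (hg : Measurable g) (a b : ℝ) :
    ∫⁻ u in Ioo a b, f u * ∫⁻ v in Ioo u b, g v = ∫⁻ v in Ioo a b, g v * ∫⁻ u in Ioo a v, f u := by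
  let T : Set (ℝ × ℝ) := {p | a < p.1 ∧ p.1 < p.2 ∧ p.2 < b}
  have hT : MeasurableSet T :=
    (measurableSet_lt measurable_const measurable_fst).inter
      ((measurableSet_lt measurable_fst measurable_snd).inter
        (measurableSet_lt measurable_snd measurable_const))
  let F : ℝ → ℝ → ℝ≥0∞ := fun u v => T.indicator (fun p => f p.1 * g p.2) (u, v)
  have hF : Measurable (Function.uncurry F) :=
    ((hf.comp measurable_fst).mul (hg.comp measurable_snd)).indicator hT
  calc
    _ = ∫⁻ u, ∫⁻ v, F u v := by
      rw [← lintegral_indicator measurableSet_Ioo]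
      refine lintegral_congr fun u => ?_
      rw [indicator_apply]
      split_ifs with hu
      · rw [← lintegral_indicator measurableSet_Ioo,
          ← lintegral_const_mul _ (hg.indicator measurableSet_Ioo)]
        refine lintegral_congr fun v => ?_
        simp only [F, T, indicator_apply, mem_Ioo, mem_ofPred_eq, hu.1, true_and, mul_ite, mul_zero]
      · refine (lintegral_eq_zero_of_ae_eq_zero (ae_of_all _ fun v => ?_)).symm
        exact indicator_of_notMem (fun h => hu ⟨h.1, h.2.1.trans h.2.2⟩) _
    _ = ∫⁻ v, ∫⁻ u, F u v := lintegral_lintegral_swap hF.aemeasurable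
    _ = _ := by
      rw [← lintegral_indicator measurableSet_Ioo]
      refine lintegral_congr fun v => ?_
      rw [indicator_apply]
      split_ifs with hv
      · rw [← lintegral_indicator measurableSet_Ioo,
          ← lintegral_const_mul _ (hf.indicator measurableSet_Ioo)]
        refine lintegral_congr fun u => ?_
        simp only [F, T, indicator_apply, mem_Ioo, mem_ofPred_eq, hv.2, and_true, mul_ite, mul_zero,
          mul_comm (f u)]
      · refine lintegral_eq_zero_of_ae_eq_zero (ae_of_all _ fun u => ?_)
        exact indicator_of_notMem (fun h => hv ⟨h.1.trans h.2.1, h.2.2⟩) _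

/-- A Beta-type double integral over the triangle `0 < u < v < 1`. -/
lemma lintegral_rpow_mul_lintegral_rpow {s b c : ℝ} (hs : 0 < s) (hb : 0 < b) (hsc : 0 < s + c) :
    ∫⁻ u in Ioo (0 : ℝ) 1, ENNReal.ofReal (u ^ (s - 1)) *
        ∫⁻ v in Ioo u 1, ENNReal.ofReal (v ^ (c - 1) * (1 - v) ^ (b - 1)) =
      ENNReal.ofReal (ProbabilityTheory.beta (s + c) b / s) := by
  rw [lintegral_triangle_swap (by fun_prop) (by fun_prop), div_eq_mul_inv,
    ENNReal.ofReal_mul (ProbabilityTheory.beta_pos hsc hb).le,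
    ← lintegral_rpow_mul_one_sub_rpow hsc hb, ← lintegral_mul_const' _ _ ENNReal.ofReal_ne_top]
  refine setLIntegral_congr_fun measurableSet_Ioo fun v hv => ?_
  have h1 : 0 ≤ (1 - v) ^ (b - 1) := Real.rpow_nonneg (by linarith [hv.2]) _
  have h2 := fun t : ℝ => Real.rpow_nonneg hv.1.le t
  rw [lintegral_rpow_Ioo hs hv.1.le, ← ENNReal.ofReal_mul (mul_nonneg (h2 _) h1),
    ← ENNReal.ofReal_mul (mul_nonneg (h2 _) h1), add_sub_assoc, Real.rpow_add hv.1]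
  congr 1
  ring

/-- Expansion of an incomplete Beta double integral in a series of Beta functions. -/
lemma integral_integral_eq_tsum_beta {a b c s : ℝ} (ha : 0 < a) (hb : 0 < b) (hc : 0 < c)
    (hs : 0 < s) :
    ∫ u in (0 : ℝ)..1, u ^ (s - 1) * (1 - u) ^ (-a) *
        ∫ v in u..(1 : ℝ), v ^ (c - 1) * (1 - v) ^ (b - 1) =
      ∑' k : ℕ, poch a k / k.factorial *
        (ProbabilityTheory.beta (s + k + c) b / (s + k)) := by
  have hint := integrableOn_rpow_mul_one_sub_rpow hc hb
  have hg0 {u : ℝ} (hu : 0 < u) : ∀ᵐ v ∂volume.restrict (Ioc u 1),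
      0 ≤ v ^ (c - 1) * (1 - v) ^ (b - 1) := by
    filter_upwards [ae_restrict_mem measurableSet_Ioc] with v hv
    exact mul_nonneg (Real.rpow_nonneg (hu.trans hv.1).le _)
      (Real.rpow_nonneg (by linarith [hv.2]) _)
  have hcoef (k : ℕ) : 0 ≤ poch a k / k.factorial := by
    have := poch_pos ha k
    positivity
  rw [intervalIntegral.integral_of_le zero_le_one, integral_Ioc_eq_integral_Ioo,
    integral_eq_lintegral_of_nonneg_ae]
  · have hexp : ∀ u ∈ Ioo (0 : ℝ) 1, ENNReal.ofReal (u ^ (s - 1) * (1 - u) ^ (-a) *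
          ∫ v in u..(1 : ℝ), v ^ (c - 1) * (1 - v) ^ (b - 1)) =
        ∑' k : ℕ, ENNReal.ofReal (poch a k / k.factorial) *
          (ENNReal.ofReal (u ^ (s + k - 1)) *
            ∫⁻ v in Ioo u 1, ENNReal.ofReal (v ^ (c - 1) * (1 - v) ^ (b - 1))) := by
      intro u hu
      have hsum := (hasSum_poch_div_factorial_mul_pow a hu.1.le hu.2).mul_left (u ^ (s - 1))
      have hnn (k : ℕ) : 0 ≤ u ^ (s - 1) * (poch a k / k.factorial * u ^ k) :=
        mul_nonneg (Real.rpow_nonneg hu.1.le _) (mul_nonneg (hcoef k) (pow_nonneg hu.1.le k))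
      rw [ENNReal.ofReal_mul (mul_nonneg (Real.rpow_nonneg hu.1.le _)
          (Real.rpow_nonneg (by linarith [hu.2]) _)), intervalIntegral.integral_of_le hu.2.le,
        ofReal_integral_eq_lintegral_ofReal
          (hint.mono_set (Ioc_subset_Icc_self.trans (Icc_subset_Icc_left hu.1.le))) (hg0 hu.1),
        Measure.restrict_congr_set Ioo_ae_eq_Ioc.symm, ← hsum.tsum_eq,
        ENNReal.ofReal_tsum_of_nonneg hnn hsum.summable, ← ENNReal.tsum_mul_right]
      refine tsum_congr fun k => ?_
      rw [← mul_assoc (ENNReal.ofReal _), ← ENNReal.ofReal_mul (hcoef k), add_sub_right_comm,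
        Real.rpow_add hu.1, Real.rpow_natCast, mul_left_comm]
    rw [setLIntegral_congr_fun measurableSet_Ioo hexp, lintegral_tsum]
    · have hterm (k : ℕ) : ∫⁻ u in Ioo (0 : ℝ) 1, ENNReal.ofReal (poch a k / k.factorial) *
          (ENNReal.ofReal (u ^ (s + k - 1)) *
            ∫⁻ v in Ioo u 1, ENNReal.ofReal (v ^ (c - 1) * (1 - v) ^ (b - 1))) =
          ENNReal.ofReal (poch a k / k.factorial *
            (ProbabilityTheory.beta (s + k + c) b / (s + k))) := by
        rw [lintegral_const_mul' _ _ ENNReal.ofReal_ne_top,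
          lintegral_rpow_mul_lintegral_rpow (by positivity) hb (by positivity),
          ← ENNReal.ofReal_mul (hcoef k)]
      simp_rw [hterm]
      rw [ENNReal.tsum_toReal_eq fun _ => ENNReal.ofReal_ne_top]
      refine tsum_congr fun k => ENNReal.toReal_ofReal (mul_nonneg (hcoef k) ?_)
      exact (div_pos (ProbabilityTheory.beta_pos (by positivity) hb) (by positivity)).le
    · intro k
      have hanti : Antitone fun u : ℝ =>
          ∫⁻ v in Ioo u 1, ENNReal.ofReal (v ^ (c - 1) * (1 - v) ^ (b - 1)) :=
        fun u u' h => lintegral_mono_set (Ioo_subset_Ioo_left h)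
      have := hanti.measurable
      fun_prop
  · filter_upwards [ae_restrict_mem measurableSet_Ioo] with u hu
    refine mul_nonneg (mul_nonneg (Real.rpow_nonneg hu.1.le _)
      (Real.rpow_nonneg (by linarith [hu.2]) _)) ?_
    rw [intervalIntegral.integral_of_le hu.2.le]
    exact integral_nonneg_of_ae (hg0 hu.1)
  · have hcont := intervalIntegral.continuousOn_primitive_interval_left
      (μ := volume) (a := 0) (b := 1) (by rwa [uIcc_of_le zero_le_one])
    rw [uIcc_of_le zero_le_one] at hcont
    have hmeas : Measurable fun u : ℝ => u ^ (s - 1) * (1 - u) ^ (-a) := by fun_prop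
    exact hmeas.aestronglyMeasurable.mul
      ((hcont.mono Ioo_subset_Icc_self).aestronglyMeasurable measurableSet_Ioo)

/-- Beta values at arguments `m + k + 1` and `n + 1/2` through Pochhammer symbols. -/
lemma beta_natCast_add_one_natCast_add_half (m n k : ℕ) :
    ProbabilityTheory.beta ((m : ℝ) + k + 1) ((n : ℝ) + 1/2) =
      m.factorial * poch (1/2) n / poch (1/2) (m + n + 1) *
        (poch ((m : ℝ) + 1) k / poch ((m : ℝ) + n + 3/2) k) := by
  have hpi := (Real.Gamma_pos_of_pos (by norm_num : (0 : ℝ) < 1/2)).ne'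
  have h1 : Real.Gamma ((m : ℝ) + k + 1) = m.factorial * poch ((m : ℝ) + 1) k := by
    rw [add_right_comm, Real.Gamma_add_natCast_eq_poch_mul (by positivity),
      Real.Gamma_nat_eq_factorial, mul_comm]
  have h2 : Real.Gamma ((n : ℝ) + 1/2) = poch (1/2) n * Real.Gamma (1/2) := by
    rw [add_comm, Real.Gamma_add_natCast_eq_poch_mul (by norm_num)]
  have h3 : Real.Gamma ((m : ℝ) + k + 1 + (n + 1/2)) =
      poch (1/2) (m + n + 1) * poch ((m : ℝ) + n + 3/2) k * Real.Gamma (1/2) := by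
    have hx : (m : ℝ) + n + 3/2 = 1/2 + (m + n + 1 : ℕ) := by push_cast; ring
    rw [hx, ← poch_add, ← Real.Gamma_add_natCast_eq_poch_mul (by norm_num)]
    congr 1
    push_cast
    ring
  rw [ProbabilityTheory.beta, h1, h2, h3]
  have h4 := (poch_pos (by norm_num : (0 : ℝ) < 1/2) (m + n + 1)).ne'
  have h5 := (poch_pos (by positivity : 0 < (m : ℝ) + n + 3/2) k).ne'
  field_simp

theorem stmt15 (m n : ℕ) :
    ∫ u in (0:ℝ)..1, u ^ ((m : ℝ) - 1/2) * (1 - u) ^ (-(1:ℝ)/2) *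
        ∫ v in u..(1:ℝ), v ^ (-(1:ℝ)/2) * (1 - v) ^ ((n : ℝ) - 1/2) =
      (m.factorial : ℝ) * poch (1/2) n / (((m : ℝ) + 1/2) * poch (1/2) (m + n + 1)) *
        ∑' k : ℕ, poch (1/2) k * poch ((m : ℝ) + 1/2) k * poch ((m : ℝ) + 1) k /
          (poch ((m : ℝ) + 3/2) k * poch ((m : ℝ) + (n : ℝ) + 3/2) k * k.factorial) := by
  have h := integral_integral_eq_tsum_beta (a := 1/2) (b := (n : ℝ) + 1/2) (c := 1/2)
    (s := (m : ℝ) + 1/2) (by norm_num) (by positivity) (by norm_num) (by positivity)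
  rw [show (m : ℝ) + 1/2 - 1 = m - 1/2 by ring, show (n : ℝ) + 1/2 - 1 = n - 1/2 by ring,
    show (1/2 : ℝ) - 1 = -1/2 by ring, show -(1/2 : ℝ) = -1/2 by ring] at h
  rw [h, ← tsum_mul_left]
  refine tsum_congr fun k => ?_
  have hquot := poch_div_poch_add_one (by positivity : 0 < (m : ℝ) + 1/2) k
  rw [show (m : ℝ) + 1/2 + 1 = m + 3/2 by ring] at hquot
  have h1 := (poch_pos (by positivity : 0 < (m : ℝ) + 3/2) k).ne'
  have h2 := (poch_pos (by norm_num : (0 : ℝ) < 1/2) (m + n + 1)).ne'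
  have h3 := (poch_pos (by positivity : 0 < (m : ℝ) + n + 3/2) k).ne'
  have h4 : (m : ℝ) + 1/2 ≠ 0 := by positivity
  have h5 : (m : ℝ) + 1/2 + k ≠ 0 := by positivity
  rw [show (m : ℝ) + 1/2 + k + 1/2 = m + k + 1 by ring, beta_natCast_add_one_natCast_add_half]
  rw [show poch (1/2) k * poch ((m : ℝ) + 1/2) k * poch ((m : ℝ) + 1) k /
      (poch ((m : ℝ) + 3/2) k * poch ((m : ℝ) + (n : ℝ) + 3/2) k * k.factorial) =
      poch (1/2) k * (poch ((m : ℝ) + 1/2) k / poch ((m : ℝ) + 3/2) k) * poch ((m : ℝ) + 1) k /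
      (poch ((m : ℝ) + (n : ℝ) + 3/2) k * k.factorial) by field_simp, hquot]
  generalize (m : ℝ) + 1/2 = s at *
  field_simp
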